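/- Consider the Liebscher copula C̃ built from bivariate copulas C₁,…,C_K. Assume each g_j^{(k)} is differentiable at 1 with derivative d_j^{(k)}, and that for each k the upper tail dependence function Λ^U_k(x,y) := x + y + lim_{ε→0⁺} (C_k(1−εx, 1−εy) − 1)/ε exists for all x, y ≥ 0. Then the upper tail dependence coefficient of C̃ exists and equals λ_U(C̃) := 2 − lim_{u→1⁻} (C̃(u,u) − 1)/(u − 1) = ∑_{k=1}^K Λ^U_k(d_1^{(k)}, d_2^{(k)}), and necessarily ∑_{k=1}^K d_j^{(k)} = 1 for j = 1, 2. -/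

import Mathlib

open Set Filter

/-- A bivariate copula: maps `[0,1]²` into `[0,1]`, has the copula boundary conditions,
and is 2-increasing. -/
def IsCopula2 (C : ℝ → ℝ → ℝ) : Prop :=
  (∀ u ∈ Set.Icc (0:ℝ) 1, ∀ v ∈ Set.Icc (0:ℝ) 1, C u v ∈ Set.Icc (0:ℝ) 1) ∧
  (∀ u ∈ Set.Icc (0:ℝ) 1, C u 0 = 0) ∧
  (∀ v ∈ Set.Icc (0:ℝ) 1, C 0 v = 0) ∧
  (∀ u ∈ Set.Icc (0:ℝ) 1, C u 1 = u) ∧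
  (∀ v ∈ Set.Icc (0:ℝ) 1, C 1 v = v) ∧
  (∀ u₁ u₂ v₁ v₂ : ℝ, 0 ≤ u₁ → u₁ ≤ u₂ → u₂ ≤ 1 → 0 ≤ v₁ → v₁ ≤ v₂ → v₂ ≤ 1 →
    0 ≤ C u₂ v₂ - C u₂ v₁ - C u₁ v₂ + C u₁ v₁)

/-- The data of Liebscher's construction: bivariate copulas `C₁,…,C_K` together with
monotone increasing functions `g_j^{(k)} : [0,1] → [0,1]` (j = 1,2) with `g_j^{(k)}(0)=0`,
`g_j^{(k)}(1)=1` and `∏_k g_j^{(k)}(u) = u` on `[0,1]`. -/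
structure LiebscherSetup (K : ℕ) where
  C : Fin K → ℝ → ℝ → ℝ
  g₁ : Fin K → ℝ → ℝ
  g₂ : Fin K → ℝ → ℝ
  copula : ∀ k, IsCopula2 (C k)
  mono₁ : ∀ k, MonotoneOn (g₁ k) (Set.Icc 0 1)
  mono₂ : ∀ k, MonotoneOn (g₂ k) (Set.Icc 0 1)
  maps₁ : ∀ k, Set.MapsTo (g₁ k) (Set.Icc 0 1) (Set.Icc 0 1)
  maps₂ : ∀ k, Set.MapsTo (g₂ k) (Set.Icc 0 1) (Set.Icc 0 1)
  zero₁ : ∀ k, g₁ k 0 = 0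
  zero₂ : ∀ k, g₂ k 0 = 0
  one₁ : ∀ k, g₁ k 1 = 1
  one₂ : ∀ k, g₂ k 1 = 1
  prodId₁ : ∀ u ∈ Set.Icc (0:ℝ) 1, ∏ k, g₁ k u = u
  prodId₂ : ∀ u ∈ Set.Icc (0:ℝ) 1, ∏ k, g₂ k u = u

/-- The Liebscher copula `C̃(u,v) = ∏_k C_k(g₁^{(k)}(u), g₂^{(k)}(v))`. -/
def LiebscherSetup.Ct {K : ℕ} (L : LiebscherSetup K) (u v : ℝ) : ℝ :=
  ∏ k, L.C k (L.g₁ k u) (L.g₂ k v)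

/-- Copulas are nondecreasing and `1`-Lipschitz in the first variable. -/
theorem IsCopula2.sub_mem_Icc_left {C : ℝ → ℝ → ℝ} (hC : IsCopula2 C) {a a' b : ℝ}
    (ha : 0 ≤ a) (haa' : a ≤ a') (ha' : a' ≤ 1) (hb : b ∈ Set.Icc (0:ℝ) 1) :
    C a' b - C a b ∈ Set.Icc 0 (a' - a) := by
  obtain ⟨-, hu0, -, hu1, -, hinc⟩ := hC
  have h₁ := hinc a a' 0 b ha haa' ha' le_rfl hb.1 hb.2
  have h₂ := hinc a a' b 1 ha haa' ha' hb.1 hb.2 le_rfl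
  rw [hu0 a ⟨ha, haa'.trans ha'⟩, hu0 a' ⟨ha.trans haa', ha'⟩] at h₁
  rw [hu1 a ⟨ha, haa'.trans ha'⟩, hu1 a' ⟨ha.trans haa', ha'⟩] at h₂
  constructor <;> linarith

/-- Exchanging the two variables of a copula gives a copula. -/
theorem IsCopula2.swap {C : ℝ → ℝ → ℝ} (hC : IsCopula2 C) : IsCopula2 fun u v => C v u := by
  obtain ⟨h, hu0, h0v, hu1, h1v, hinc⟩ := hC
  refine ⟨fun u hu v hv => h v hv u hu, h0v, hu0, h1v, hu1, ?_⟩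
  intro u₁ u₂ v₁ v₂ hu₁ hu hu₂ hv₁ hv hv₂
  linarith [hinc v₁ v₂ u₁ u₂ hv₁ hv hv₂ hu₁ hu hu₂]

theorem IsCopula2.abs_sub_le_left {C : ℝ → ℝ → ℝ} (hC : IsCopula2 C) {a a' b : ℝ}
    (ha : a ∈ Set.Icc (0:ℝ) 1) (ha' : a' ∈ Set.Icc (0:ℝ) 1) (hb : b ∈ Set.Icc (0:ℝ) 1) :
    |C a b - C a' b| ≤ |a - a'| := by
  rcases le_total a a' with h | h
  · have := hC.sub_mem_Icc_left ha.1 h ha'.2 hb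
    rw [abs_sub_comm, abs_sub_comm a, abs_of_nonneg this.1]
    exact this.2.trans (le_abs_self _)
  · have := hC.sub_mem_Icc_left ha'.1 h ha.2 hb
    rw [abs_of_nonneg this.1]
    exact this.2.trans (le_abs_self _)

/-- Copulas are `1`-Lipschitz for the `ℓ¹` distance. -/
theorem IsCopula2.abs_sub_le {C : ℝ → ℝ → ℝ} (hC : IsCopula2 C) {a a' b b' : ℝ}
    (ha : a ∈ Set.Icc (0:ℝ) 1) (ha' : a' ∈ Set.Icc (0:ℝ) 1)
    (hb : b ∈ Set.Icc (0:ℝ) 1) (hb' : b' ∈ Set.Icc (0:ℝ) 1) :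
    |C a b - C a' b'| ≤ |a - a'| + |b - b'| :=
  (_root_.abs_sub_le _ (C a' b) _).trans
    (add_le_add (hC.abs_sub_le_left ha ha' hb) (hC.swap.abs_sub_le_left hb hb' ha'))

theorem IsCopula2.apply_one_one {C : ℝ → ℝ → ℝ} (hC : IsCopula2 C) : C 1 1 = 1 :=
  hC.2.2.2.1 1 ⟨zero_le_one, le_rfl⟩

theorem Icc_zero_one_mem_nhdsLT_one : Set.Icc (0:ℝ) 1 ∈ nhdsWithin (1:ℝ) (Set.Iio 1) :=
  Filter.mem_of_superset (Ioo_mem_nhdsLT zero_lt_one) Set.Ioo_subset_Icc_self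

theorem eventually_one_sub_mul_mem_Icc {d : ℝ} (hd : 0 ≤ d) :
    ∀ᶠ u in nhdsWithin (1:ℝ) (Set.Iio 1), 1 - (1 - u) * d ∈ Set.Icc (0:ℝ) 1 := by
  have hcont : Filter.Tendsto (fun u : ℝ => 1 - (1 - u) * d) (nhdsWithin 1 (Set.Iio 1))
      (nhds (1 - (1 - 1) * d)) :=
    (Continuous.tendsto (by fun_prop) _).mono_left nhdsWithin_le_nhds
  filter_upwards [self_mem_nhdsWithin, hcont.eventually (lt_mem_nhds (a := 0) (by simp))]
    with u hu hpos
  exact ⟨hpos.le, by nlinarith [mul_nonneg (sub_nonneg.2 (le_of_lt hu)) hd]⟩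

/-- A copula with directional derivative at `(1, 1)` along straight lines is differentiable from
the left along every curve reaching `(1, 1)` with the corresponding velocity. -/
theorem IsCopula2.hasDerivWithinAt_comp {C : ℝ → ℝ → ℝ} (hC : IsCopula2 C) {f g : ℝ → ℝ}
    {x y l : ℝ} (hx : 0 ≤ x) (hy : 0 ≤ y)
    (hfm : Set.MapsTo f (Set.Icc 0 1) (Set.Icc 0 1))
    (hgm : Set.MapsTo g (Set.Icc 0 1) (Set.Icc 0 1)) (hf1 : f 1 = 1) (hg1 : g 1 = 1)
    (hf : HasDerivWithinAt f x (Set.Iio 1) 1) (hg : HasDerivWithinAt g y (Set.Iio 1) 1)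
    (hl : Filter.Tendsto (fun ε => (C (1 - ε * x) (1 - ε * y) - 1) / ε)
      (nhdsWithin 0 (Set.Ioi 0)) (nhds l)) :
    HasDerivWithinAt (fun u => C (f u) (g u)) (-l) (Set.Iio 1) 1 := by
  have hline : HasDerivWithinAt (fun u => C (1 - (1 - u) * x) (1 - (1 - u) * y)) (-l)
      (Set.Iio 1) 1 := by
    rw [hasDerivWithinAt_iff_tendsto_slope' (by simp)]
    have hsub : Filter.Tendsto (fun u : ℝ => 1 - u) (nhdsWithin 1 (Set.Iio 1))
        (nhdsWithin 0 (Set.Ioi 0)) := by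
      refine tendsto_nhdsWithin_iff.2 ⟨?_, ?_⟩
      · refine Filter.Tendsto.mono_left ?_ nhdsWithin_le_nhds
        exact Continuous.tendsto' (by fun_prop) _ _ (by simp)
      · filter_upwards [self_mem_nhdsWithin] with u hu
        exact sub_pos.2 (Set.mem_Iio.1 hu)
    refine (hl.comp hsub).neg.congr fun u => ?_
    simp only [Function.comp_apply, slope_def_field, sub_self, zero_mul, sub_zero,
      hC.apply_one_one]
    rw [← div_neg, neg_sub]
  have hdiff : HasDerivWithinAt
      (fun u => C (f u) (g u) - C (1 - (1 - u) * x) (1 - (1 - u) * y)) 0 (Set.Iio 1) 1 := by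
    rw [hasDerivWithinAt_iff_isLittleO] at hf hg ⊢
    refine Asymptotics.IsBigO.trans_isLittleO ?_ (hf.norm_left.add hg.norm_left)
    refine Asymptotics.IsBigO.of_bound 1 ?_
    filter_upwards [Icc_zero_one_mem_nhdsLT_one, eventually_one_sub_mul_mem_Icc hx,
      eventually_one_sub_mul_mem_Icc hy] with u hu hux huy
    have := hC.abs_sub_le (hfm hu) hux (hgm hu) huy
    simp only [hf1, hg1, sub_self, zero_mul, mul_zero, sub_zero, smul_eq_mul, Real.norm_eq_abs,
      one_mul]
    refine this.trans (le_trans (le_of_eq ?_) (le_abs_self _))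
    congr 2 <;> ring
  simpa [Pi.add_def, -hasDerivWithinAt_Iio_iff_Iic] using hdiff.add hline

/-- If functions equal to `1` at `1` multiply to the identity of `[0, 1]`, their derivatives at `1`
add up to `1`. -/
theorem sum_deriv_eq_one_of_prod_eq_id {ι : Type*} [Fintype ι] {g : ι → ℝ → ℝ} {d : ι → ℝ}
    (h1 : ∀ k, g k 1 = 1) (hprod : ∀ u ∈ Set.Icc (0:ℝ) 1, ∏ k, g k u = u)
    (hd : ∀ k, HasDerivWithinAt (g k) (d k) (Set.Icc 0 1) 1) : ∑ k, d k = 1 := by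
  classical
  have hone : (1:ℝ) ∈ Set.Icc (0:ℝ) 1 := ⟨zero_le_one, le_rfl⟩
  have h := HasDerivWithinAt.fun_finsetProd (u := Finset.univ) fun k _ => hd k
  simp only [h1, Finset.prod_const_one, one_smul] at h
  exact (uniqueDiffOn_Icc zero_lt_one 1 hone).eq_deriv _ h
    ((hasDerivWithinAt_id _ _).congr hprod (hprod 1 hone))

theorem MonotoneOn.hasDerivWithinAt_Icc_nonneg {f : ℝ → ℝ} {d : ℝ}
    (hf : MonotoneOn f (Set.Icc 0 1)) (hd : HasDerivWithinAt f d (Set.Icc 0 1) 1) : 0 ≤ d := by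
  rw [← hd.derivWithin (uniqueDiffOn_Icc zero_lt_one 1 ⟨zero_le_one, le_rfl⟩)]
  exact hf.derivWithin_nonneg

/-- **Upper tail dependence coefficient of a Liebscher copula, general case.**
Under differentiability at 1 of the `g_j^{(k)}` with derivatives `d_j^{(k)}` and existence
of the upper tail dependence functions `Λ^U_k` of the `C_k`, one has `∑_k d_j^{(k)} = 1`
for `j = 1,2`, and the upper tail dependence coefficient of `C̃` exists and equals
`λ_U(C̃) = 2 − lim_{u→1⁻} (C̃(u,u)−1)/(u−1) = ∑_k Λ^U_k(d₁^{(k)}, d₂^{(k)})`. -/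
theorem liebscher_upper_tail_coefficient (K : ℕ) (hK : 1 ≤ K) (L : LiebscherSetup K)
    (d₁ d₂ : Fin K → ℝ)
    (hd₁ : ∀ k, HasDerivWithinAt (L.g₁ k) (d₁ k) (Set.Icc 0 1) 1)
    (hd₂ : ∀ k, HasDerivWithinAt (L.g₂ k) (d₂ k) (Set.Icc 0 1) 1)
    (ΛU : Fin K → ℝ → ℝ → ℝ)
    (hΛU : ∀ k, ∀ x ≥ (0:ℝ), ∀ y ≥ (0:ℝ),
      Filter.Tendsto (fun ε => (L.C k (1 - ε * x) (1 - ε * y) - 1) / ε)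
        (nhdsWithin 0 (Set.Ioi 0)) (nhds (ΛU k x y - x - y))) :
    ((∑ k, d₁ k = 1) ∧ (∑ k, d₂ k = 1)) ∧
    Filter.Tendsto (fun u => (L.Ct u u - 1) / (u - 1)) (nhdsWithin 1 (Set.Iio 1))
      (nhds (2 - ∑ k, ΛU k (d₁ k) (d₂ k))) := by
  refine ⟨⟨sum_deriv_eq_one_of_prod_eq_id L.one₁ L.prodId₁ hd₁,
    sum_deriv_eq_one_of_prod_eq_id L.one₂ L.prodId₂ hd₂⟩, ?_⟩
  have hfac : ∀ k, HasDerivWithinAt (fun u => L.C k (L.g₁ k u) (L.g₂ k u))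
      (-(ΛU k (d₁ k) (d₂ k) - d₁ k - d₂ k)) (Set.Iio 1) 1 := fun k =>
    have h₁ := (L.mono₁ k).hasDerivWithinAt_Icc_nonneg (hd₁ k)
    have h₂ := (L.mono₂ k).hasDerivWithinAt_Icc_nonneg (hd₂ k)
    (L.copula k).hasDerivWithinAt_comp h₁ h₂ (L.maps₁ k) (L.maps₂ k) (L.one₁ k) (L.one₂ k)
      ((hd₁ k).mono_of_mem_nhdsWithin Icc_zero_one_mem_nhdsLT_one)
      ((hd₂ k).mono_of_mem_nhdsWithin Icc_zero_one_mem_nhdsLT_one)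
      (hΛU k _ h₁ _ h₂)
  have hone : ∀ k, L.C k (L.g₁ k 1) (L.g₂ k 1) = 1 := fun k => by
    rw [L.one₁, L.one₂, (L.copula k).apply_one_one]
  have hCt := HasDerivWithinAt.fun_finsetProd (u := Finset.univ) fun k _ => hfac k
  rw [hasDerivWithinAt_iff_tendsto_slope' (by simp)] at hCt
  convert hCt using 2
  · simp [slope_def_field, LiebscherSetup.Ct, hone]
  · simp only [hone, Finset.prod_const_one, one_smul, Finset.sum_neg_distrib,
      Finset.sum_sub_distrib, sum_deriv_eq_one_of_prod_eq_id L.one₁ L.prodId₁ hd₁,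
      sum_deriv_eq_one_of_prod_eq_id L.one₂ L.prodId₂ hd₂]
    ring
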